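/- The right-hand limit of G at 0 equals min{0, c₀ − c₁ − c_e·μ_x²}; that is, lim_{U→0⁺} G(U) = min{0, c₀ − c₁ − c_e·μ_x²}. -/

import Mathlib

open MeasureTheory Real Filter Set

/-- κ = σ²/σx² -/
noncomputable def kap (σ σx : ℝ) : ℝ := σ ^ 2 / σx ^ 2

/-- The marginalized likelihood ratio L(U,V). -/
noncomputable def Lf (σ σx μx U V : ℝ) : ℝ :=
  σ / σx / Real.sqrt (U + kap σ σx) *
    Real.exp ((V + μx * kap σ σx) ^ 2 / (2 * σ ^ 2 * (U + kap σ σx)) - μx ^ 2 / (2 * σx ^ 2))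

/-- The optimum estimate m(U,V). -/
noncomputable def mf (σ σx μx U V : ℝ) : ℝ :=
  (V + μx * kap σ σx) / (U + kap σ σx)

/-- ℓ(U,V) = L(U,V)(c₁ + c_e m(U,V)²). -/
noncomputable def ellf (σ σx μx c₁ ce U V : ℝ) : ℝ :=
  Lf σ σx μx U V * (c₁ + ce * (mf σ σx μx U V) ^ 2)

/-- G(U) = ∫ min{0, c₀ − ℓ(U,V)} N(0, σ²U)(dV). -/
noncomputable def Gf (σ σx μx c₀ c₁ ce U : ℝ) : ℝ :=
  ∫ V : ℝ, min 0 (c₀ - ellf σ σx μx c₁ ce U V) *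
    ((Real.sqrt (2 * Real.pi * σ ^ 2 * U))⁻¹ * Real.exp (-V ^ 2 / (2 * σ ^ 2 * U)))

theorem kap_pos {σ σx : ℝ} (hσ : 0 < σ) (hσx : 0 < σx) : 0 < kap σ σx := by
  unfold kap; positivity

theorem ellf_nonneg {σ σx c₁ ce : ℝ} (μx U V : ℝ) (hσ : 0 < σ) (hσx : 0 < σx)
    (hc₁ : 0 ≤ c₁) (hce : 0 ≤ ce) : 0 ≤ ellf σ σx μx c₁ ce U V := by
  unfold ellf Lf; positivity

theorem ellf_zero_zero {σ σx : ℝ} (μx c₁ ce : ℝ) (hσ : 0 < σ) (hσx : 0 < σx) :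
    ellf σ σx μx c₁ ce 0 0 = c₁ + ce * μx ^ 2 := by
  have hk := kap_pos hσ hσx
  have hs : Real.sqrt (kap σ σx) = σ / σx := by
    rw [kap, ← div_pow, Real.sqrt_sq (by positivity)]
  have he : (μx * kap σ σx) ^ 2 / (2 * σ ^ 2 * kap σ σx) - μx ^ 2 / (2 * σx ^ 2) = 0 := by
    unfold kap; field_simp; ring
  have hm : μx * kap σ σx / kap σ σx = μx := mul_div_cancel_right₀ _ hk.ne'
  have hd : σ / σx / (σ / σx) = 1 := div_self (by positivity)
  simp only [ellf, Lf, mf, zero_add, hs, he, hm, hd, Real.exp_zero, one_mul]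

/-- Rescaling `V = √U x` turns the Gaussian weight of variance `σ² U` into one of variance `σ²`. -/
theorem Gf_eq_integral_sqrt_mul (σ σx μx c₀ c₁ ce : ℝ) {U : ℝ} (hU : 0 < U) :
    Gf σ σx μx c₀ c₁ ce U = ∫ x : ℝ, min 0 (c₀ - ellf σ σx μx c₁ ce U (Real.sqrt U * x)) *
      ((Real.sqrt (2 * Real.pi * σ ^ 2))⁻¹ * Real.exp (-(2 * σ ^ 2)⁻¹ * x ^ 2)) := by
  have hs : 0 < Real.sqrt U := Real.sqrt_pos.2 hU
  have h := Measure.integral_comp_mul_left (fun V : ℝ => min 0 (c₀ - ellf σ σx μx c₁ ce U V) *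
    ((Real.sqrt (2 * Real.pi * σ ^ 2 * U))⁻¹ * Real.exp (-V ^ 2 / (2 * σ ^ 2 * U)))) (Real.sqrt U)
  rw [abs_of_pos (inv_pos.2 hs), smul_eq_mul, eq_inv_mul_iff_mul_eq₀ hs.ne',
    ← integral_const_mul] at h
  rw [Gf, ← h]
  congr 1
  ext x
  have he : -(Real.sqrt U * x) ^ 2 / (2 * σ ^ 2 * U) = -(2 * σ ^ 2)⁻¹ * x ^ 2 := by
    rw [mul_pow, Real.sq_sqrt hU.le]
    rcases eq_or_ne σ 0 with rfl | hσ
    · simp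
    · field_simp
  rw [he, Real.sqrt_mul' _ hU.le, mul_inv]
  field_simp

/-- A bound on `ℓ(U, √U x)` that is uniform in small `U`. -/
theorem ellf_sqrt_mul_le {σ σx c₁ ce : ℝ} (μx x : ℝ) {U : ℝ} (hσ : 0 < σ) (hσx : 0 < σx)
    (hc₁ : 0 ≤ c₁) (hce : 0 ≤ ce) (hU : 0 ≤ U) (hUk : U ≤ kap σ σx / 4) :
    ellf σ σx μx c₁ ce U (Real.sqrt U * x) ≤
      Real.exp (μx ^ 2 / σx ^ 2 + (4 * σ ^ 2)⁻¹ * x ^ 2) *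
        (c₁ + ce * (x ^ 2 / kap σ σx + 2 * μx ^ 2)) := by
  have hk := kap_pos hσ hσx
  have hkσ : kap σ σx * σx ^ 2 = σ ^ 2 := by unfold kap; field_simp
  set k := kap σ σx with hkdef
  have hV : (Real.sqrt U * x + μx * k) ^ 2 ≤ k / 2 * x ^ 2 + 2 * μx ^ 2 * k ^ 2 := by
    have h1 : (Real.sqrt U * x) ^ 2 ≤ k / 4 * x ^ 2 := by
      rw [mul_pow, Real.sq_sqrt hU]; gcongr
    nlinarith [sq_nonneg (Real.sqrt U * x - μx * k)]
  have hpre : σ / σx / Real.sqrt (U + k) ≤ 1 := by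
    rw [div_le_one (by positivity)]
    apply Real.le_sqrt_of_sq_le
    rw [div_pow, hkdef, kap]
    linarith
  have hexp : (Real.sqrt U * x + μx * k) ^ 2 / (2 * σ ^ 2 * (U + k)) - μx ^ 2 / (2 * σx ^ 2) ≤
      μx ^ 2 / σx ^ 2 + (4 * σ ^ 2)⁻¹ * x ^ 2 := by
    have h1 : (Real.sqrt U * x + μx * k) ^ 2 / (2 * σ ^ 2 * (U + k)) ≤
        (k / 2 * x ^ 2 + 2 * μx ^ 2 * k ^ 2) / (2 * σ ^ 2 * k) := by
      gcongr; linarith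
    have h2 : (k / 2 * x ^ 2 + 2 * μx ^ 2 * k ^ 2) / (2 * σ ^ 2 * k) =
        μx ^ 2 / σx ^ 2 + (4 * σ ^ 2)⁻¹ * x ^ 2 := by
      rw [← hkσ]; field_simp; ring
    have h3 : 0 ≤ μx ^ 2 / (2 * σx ^ 2) := by positivity
    linarith
  have hm : ((Real.sqrt U * x + μx * k) / (U + k)) ^ 2 ≤ x ^ 2 / k + 2 * μx ^ 2 := by
    rw [div_pow]
    calc _ ≤ (k / 2 * x ^ 2 + 2 * μx ^ 2 * k ^ 2) / k ^ 2 := by gcongr; linarith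
      _ = x ^ 2 / k / 2 + 2 * μx ^ 2 := by field_simp
      _ ≤ _ := by
        have : 0 ≤ x ^ 2 / k := by positivity
        linarith
  unfold ellf Lf mf
  rw [← hkdef]
  have hL : σ / σx / Real.sqrt (U + k) * Real.exp ((Real.sqrt U * x + μx * k) ^ 2 /
      (2 * σ ^ 2 * (U + k)) - μx ^ 2 / (2 * σx ^ 2)) ≤
      Real.exp (μx ^ 2 / σx ^ 2 + (4 * σ ^ 2)⁻¹ * x ^ 2) := by
    rw [← one_mul (Real.exp (μx ^ 2 / σx ^ 2 + _))]
    gcongr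
  gcongr

theorem integrable_sq_add_const_mul_exp_neg_mul_sq (a b : ℝ) {r : ℝ} (hr : 0 < r) :
    Integrable fun x : ℝ => (a + b * x ^ 2) * Real.exp (-r * x ^ 2) := by
  have h1 := (integrable_exp_neg_mul_sq hr).const_mul a
  have h2 := (integrable_rpow_mul_exp_neg_mul_sq hr (s := 2) (by norm_num)).const_mul b
  refine (h1.add h2).congr (.of_forall fun x => ?_)
  simp only [Pi.add_apply, Real.rpow_two]
  ring

theorem integral_gaussian_density {σ : ℝ} (hσ : 0 < σ) :
    ∫ x : ℝ, (Real.sqrt (2 * Real.pi * σ ^ 2))⁻¹ * Real.exp (-(2 * σ ^ 2)⁻¹ * x ^ 2) = 1 := by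
  rw [integral_const_mul, integral_gaussian, div_inv_eq_mul,
    show Real.pi * (2 * σ ^ 2) = 2 * Real.pi * σ ^ 2 by ring]
  exact inv_mul_cancel₀ (by positivity)

/-- lim_{U→0⁺} G(U) = min{0, c₀ − c₁ − c_e μ_x²}. -/
theorem G_tendsto_zero_right (σ σx μx c₀ c₁ ce : ℝ) (hσ : 0 < σ) (hσx : 0 < σx)
    (hc₀ : 0 ≤ c₀) (hc₁ : 0 ≤ c₁) (hce : 0 ≤ ce) :
    Filter.Tendsto (Gf σ σx μx c₀ c₁ ce) (nhdsWithin 0 (Set.Ioi (0 : ℝ)))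
      (nhds (min 0 (c₀ - c₁ - ce * μx ^ 2))) := by
  have hk := kap_pos hσ hσx
  set A := (Real.sqrt (2 * Real.pi * σ ^ 2))⁻¹ with hA
  have hA0 : 0 ≤ A := by positivity
  have hlim : min 0 (c₀ - c₁ - ce * μx ^ 2) = ∫ x : ℝ, min 0 (c₀ - c₁ - ce * μx ^ 2) *
      (A * Real.exp (-(2 * σ ^ 2)⁻¹ * x ^ 2)) := by
    rw [integral_const_mul, integral_gaussian_density hσ, mul_one]
  rw [hlim]
  refine Filter.Tendsto.congr'
    (f₁ := fun U => ∫ x : ℝ, min 0 (c₀ - ellf σ σx μx c₁ ce U (Real.sqrt U * x)) *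
      (A * Real.exp (-(2 * σ ^ 2)⁻¹ * x ^ 2))) ?_ ?_
  · filter_upwards [self_mem_nhdsWithin] with U hU
    exact (Gf_eq_integral_sqrt_mul σ σx μx c₀ c₁ ce hU).symm
  have hint := (integrable_sq_add_const_mul_exp_neg_mul_sq (c₁ + ce * (2 * μx ^ 2))
    (ce / kap σ σx) (r := (4 * σ ^ 2)⁻¹) (by positivity)).const_mul
      (A * Real.exp (μx ^ 2 / σx ^ 2))
  refine tendsto_integral_filter_of_dominated_convergence _ ?_ ?_ hint ?_
  · refine .of_forall fun U => Measurable.aestronglyMeasurable ?_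
    unfold ellf Lf mf
    fun_prop
  · filter_upwards [self_mem_nhdsWithin,
      nhdsWithin_le_nhds (Iic_mem_nhds (by positivity : 0 < kap σ σx / 4))] with U hU hUk
    refine .of_forall fun x => ?_
    have h0 := ellf_nonneg μx U (Real.sqrt U * x) hσ hσx hc₁ hce
    have hle := ellf_sqrt_mul_le μx x hσ hσx hc₁ hce (le_of_lt hU) hUk
    have hmin : |min 0 (c₀ - ellf σ σx μx c₁ ce U (Real.sqrt U * x))| ≤
        ellf σ σx μx c₁ ce U (Real.sqrt U * x) :=
      abs_le.2 ⟨le_min (by linarith) (by linarith), (min_le_left _ _).trans h0⟩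
    rw [Real.norm_eq_abs, abs_mul, abs_of_nonneg (by positivity : 0 ≤ A * Real.exp _)]
    have hE : Real.exp (μx ^ 2 / σx ^ 2 + (4 * σ ^ 2)⁻¹ * x ^ 2) *
        Real.exp (-(2 * σ ^ 2)⁻¹ * x ^ 2) =
        Real.exp (μx ^ 2 / σx ^ 2) * Real.exp (-(4 * σ ^ 2)⁻¹ * x ^ 2) := by
      rw [← Real.exp_add, ← Real.exp_add]
      congr 1
      field_simp
      ring
    calc _ ≤ _ := mul_le_mul_of_nonneg_right (hmin.trans hle) (by positivity)
      _ = A * (c₁ + ce * (x ^ 2 / kap σ σx + 2 * μx ^ 2)) *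
          (Real.exp (μx ^ 2 / σx ^ 2 + (4 * σ ^ 2)⁻¹ * x ^ 2) *
            Real.exp (-(2 * σ ^ 2)⁻¹ * x ^ 2)) := by ring
      _ = _ := by rw [hE]; ring
  · refine .of_forall fun x => Filter.Tendsto.mul_const _ ?_
    have hc : ContinuousAt (fun U => min 0 (c₀ - ellf σ σx μx c₁ ce U (Real.sqrt U * x))) 0 := by
      have h1 : Real.sqrt (0 + kap σ σx) ≠ 0 := by
        rw [zero_add]; positivity
      have h2 : 0 + kap σ σx ≠ 0 := by rw [zero_add]; exact hk.ne'
      have h3 : 2 * σ ^ 2 * (0 + kap σ σx) ≠ 0 := mul_ne_zero (by positivity) h2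
      unfold ellf Lf mf
      fun_prop (disch := assumption)
    have ht := hc.tendsto.mono_left (nhdsWithin_le_nhds (s := Set.Ioi 0))
    simpa only [Real.sqrt_zero, zero_mul, ellf_zero_zero μx c₁ ce hσ hσx, ← sub_sub] using ht
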